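/- Let T = (e₁,…,e₅) be a list of five 4-tuples of pairwise distinct indices in {1,…,8} covering every index. Suppose some vertex of {1,…,8} has degree 1 with respect to T, and no tuple eᵢ contains two or more vertices of degree 1. Then the cross-ratio degree of T is at most 2: there exists a nonzero polynomial q ∈ ℂ[x₁,…,x₅] such that N_T(a) ≤ 2 for every a ∈ (ℂ∖{0,1})⁵ with q(a) ≠ 0. -/

import Mathlib

open OnePoint

/-- Cross-ratio of four points of `ℙ¹(ℂ) = OnePoint ℂ`:
`CR(z₁,z₂,z₃,z₄) = ((z₃−z₁)(z₄−z₂))/((z₃−z₂)(z₄−z₁))` when all points are finite,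
extended to one point at infinity by omitting the two factors containing it. -/
noncomputable def CR : OnePoint ℂ → OnePoint ℂ → OnePoint ℂ → OnePoint ℂ → ℂ
  | Option.none,    Option.some z₂, Option.some z₃, Option.some z₄ => (z₄ - z₂) / (z₃ - z₂)
  | Option.some z₁, Option.none,    Option.some z₃, Option.some z₄ => (z₃ - z₁) / (z₄ - z₁)
  | Option.some z₁, Option.some z₂, Option.none,    Option.some z₄ => (z₄ - z₂) / (z₄ - z₁)
  | Option.some z₁, Option.some z₂, Option.some z₃, Option.none    => (z₃ - z₁) / (z₃ - z₂)
  | Option.some z₁, Option.some z₂, Option.some z₃, Option.some z₄ =>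
      ((z₃ - z₁) * (z₄ - z₂)) / ((z₃ - z₂) * (z₄ - z₁))
  | _, _, _, _ => 0

/-- The degree of a vertex `v` with respect to the datum `T`:
the number of indices `i` such that `v` occurs in the tuple `eᵢ = T i`. -/
def degT (T : Fin 5 → Fin 4 → Fin 8) (v : Fin 8) : ℕ :=
  (Finset.univ.filter fun i => ∃ j, T i j = v).card

/-- Homogeneous coordinates of a point of `ℙ¹(ℂ)`. -/
def homCoord : OnePoint ℂ → ℂ × ℂ
  | Option.none => (1, 0)
  | Option.some z => (z, 1)

/-- The determinant of two vectors of `ℂ²`. -/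
def bracket (u v : ℂ × ℂ) : ℂ := u.1 * v.2 - u.2 * v.1

/-- A family of vectors of `ℂ²` representing pairwise distinct points of `ℙ¹(ℂ)`. -/
def IsGeneral {V : Type*} (p : V → ℂ × ℂ) : Prop :=
  ∀ ⦃v w : V⦄, v ≠ w → bracket (p v) (p w) ≠ 0

/-- The cross-ratio of four members of a family of vectors of `ℂ²`. -/
noncomputable def crossRatio {V : Type*} (p : V → ℂ × ℂ) (w x y z : V) : ℂ :=
  bracket (p w) (p y) * bracket (p x) (p z) / (bracket (p x) (p y) * bracket (p w) (p z))

/-- The family with affine coordinates `x`, except for the member `b` placed at infinity. -/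
def affinize {V : Type*} [DecidableEq V] (b : V) (x : V → ℂ) (v : V) : ℂ × ℂ :=
  if v = b then (1, 0) else (x v, 1)

/-- Two families have the same cross-ratios on `Z`. -/
def AgreeOn {V : Type*} (p p' : V → ℂ × ℂ) (Z : Finset V) : Prop :=
  ∀ w ∈ Z, ∀ x ∈ Z, ∀ y ∈ Z, ∀ z ∈ Z, crossRatio p w x y z = crossRatio p' w x y z

section CrossRatio

variable {V : Type*} {p p' : V → ℂ × ℂ}

lemma bracket_self (u : ℂ × ℂ) : bracket u u = 0 := by
  simp only [bracket]; ring

lemma bracket_swap (u v : ℂ × ℂ) : bracket u v = -bracket v u := by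
  simp only [bracket]; ring

lemma crossRatio_mul_swap (hp : IsGeneral p) {w x y z : V} (hwy : w ≠ y) (hxz : x ≠ z)
    (hxy : x ≠ y) (hwz : w ≠ z) : crossRatio p w x y z * crossRatio p x w y z = 1 := by
  have h1 := hp hwy
  have h2 := hp hxz
  have h3 := hp hxy
  have h4 := hp hwz
  simp only [crossRatio]
  field_simp

lemma crossRatio_cycle (hp : IsGeneral p) {w x y z t : V} (hwy : w ≠ y) (hxy : x ≠ y)
    (hwz : w ≠ z) (hxz : x ≠ z) (hwt : w ≠ t) (hxt : x ≠ t) :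
    crossRatio p w x y z * crossRatio p w x z t * crossRatio p w x t y = 1 := by
  have h1 := hp hwy
  have h2 := hp hxz
  have h3 := hp hxy
  have h4 := hp hwz
  have h5 := hp hwt
  have h6 := hp hxt
  simp only [crossRatio]
  field_simp

lemma crossRatio_ne_zero (hp : IsGeneral p) {w x y z : V} (hwy : w ≠ y) (hxz : x ≠ z)
    (hxy : x ≠ y) (hwz : w ≠ z) : crossRatio p w x y z ≠ 0 :=
  left_ne_zero_of_mul_eq_one (crossRatio_mul_swap hp hwy hxz hxy hwz)

lemma crossRatio_ne_one (hp : IsGeneral p) {w x y z : V} (hwx : w ≠ x) (hxy : x ≠ y)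
    (hwz : w ≠ z) (hyz : y ≠ z) : crossRatio p w x y z ≠ 1 := by
  intro h
  have h1 := hp hxy
  have h2 := hp hwz
  rw [crossRatio, div_eq_one_iff_eq (mul_ne_zero h1 h2)] at h
  refine mul_ne_zero (hp hwx) (hp hyz) ?_
  simp only [bracket] at h ⊢
  linear_combination h

lemma crossRatio_of_bracket_eq {κ : ℂ} {s : V → ℂ} (hκ : κ ≠ 0) (hs : ∀ v, s v ≠ 0)
    (h : ∀ v w, bracket (p' v) (p' w) = κ * s v * s w * bracket (p v) (p w)) (w x y z : V) :
    crossRatio p' w x y z = crossRatio p w x y z := by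
  have hw := hs w
  have hx := hs x
  have hy := hs y
  have hz := hs z
  have h1 : κ ^ 2 * s w * s x * s y * s z ≠ 0 := by positivity
  rw [crossRatio, crossRatio, h, h, h, h,
    ← mul_div_mul_left (bracket (p w) (p y) * bracket (p x) (p z)) _ h1]
  congr 1 <;> ring

lemma crossRatio_base_zero (b₁ b₂ b₃ : V) : crossRatio p b₁ b₂ b₃ b₂ = 0 := by
  simp [crossRatio, bracket_self]

lemma crossRatio_base_one (hp : IsGeneral p) {b₁ b₂ b₃ : V} (h₁₃ : b₁ ≠ b₃) (h₂₃ : b₂ ≠ b₃) :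
    crossRatio p b₁ b₂ b₃ b₃ = 1 := by
  have h1 := hp h₁₃
  have h2 := hp h₂₃
  rw [crossRatio]
  field_simp

lemma crossRatio_base_injective (hp : IsGeneral p) {b₁ b₂ b₃ : V} (h₁₃ : b₁ ≠ b₃)
    (h₂₃ : b₂ ≠ b₃) (h₁₂ : b₁ ≠ b₂) {v w : V} (hv : v ≠ b₁) (hw : w ≠ b₁) (hvw : v ≠ w) :
    crossRatio p b₁ b₂ b₃ v ≠ crossRatio p b₁ b₂ b₃ w := by
  have h1 := hp h₁₃
  have h2 := hp h₂₃
  have h3 := hp hv.symm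
  have h4 := hp hw.symm
  intro h
  rw [crossRatio, crossRatio, div_eq_div_iff (mul_ne_zero h2 h3) (mul_ne_zero h2 h4)] at h
  have h5 : bracket (p b₁) (p b₃) * bracket (p b₂) (p b₃) *
      (bracket (p b₁) (p b₂) * bracket (p v) (p w)) = 0 := by
    simp only [bracket] at h ⊢
    linear_combination -h
  exact mul_ne_zero (mul_ne_zero h1 h2) (mul_ne_zero (hp h₁₂) (hp hvw)) h5

lemma AgreeOn.mono {Z Z' : Finset V} (h : AgreeOn p p' Z) (hZ : Z' ⊆ Z) : AgreeOn p p' Z' :=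
  fun w hw x hx y hy z hz => h w (hZ hw) x (hZ hx) y (hZ hy) z (hZ hz)

variable [DecidableEq V]

lemma crossRatio_affinize (hp : IsGeneral p) {b₁ b₂ b₃ : V} (h₁₂ : b₁ ≠ b₂) (h₁₃ : b₁ ≠ b₃)
    (h₂₃ : b₂ ≠ b₃) (w x y z : V) :
    crossRatio (affinize b₁ (crossRatio p b₁ b₂ b₃)) w x y z = crossRatio p w x y z := by
  have h1 := hp h₁₃
  have h2 := hp h₂₃
  have h3 := hp h₁₂.symm
  set κ : ℂ := bracket (p b₁) (p b₃) * bracket (p b₂) (p b₁) / bracket (p b₂) (p b₃) with hκ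
  have hκ0 : κ ≠ 0 := div_ne_zero (mul_ne_zero h1 h3) h2
  refine crossRatio_of_bracket_eq (κ := κ)
    (s := fun v => if v = b₁ then κ⁻¹ else (bracket (p b₁) (p v))⁻¹) hκ0 ?_ ?_ w x y z
  · intro v
    split_ifs with hv
    · exact inv_ne_zero hκ0
    · exact inv_ne_zero (hp (Ne.symm hv))
  · intro v w
    by_cases hv : v = b₁ <;> by_cases hw : w = b₁
    · simp [hv, hw, bracket_self]
    · have h4 := hp (Ne.symm hw)
      rw [if_pos hv, if_neg hw, mul_inv_cancel₀ hκ0, one_mul, hv, inv_mul_cancel₀ h4]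
      simp [affinize, hw, bracket]
    · have h4 := hp (Ne.symm hv)
      rw [if_neg hv, if_pos hw, mul_right_comm κ, mul_inv_cancel₀ hκ0, one_mul, hw,
        bracket_swap (p v), mul_neg, inv_mul_cancel₀ h4]
      simp [affinize, hv, bracket]
    · have h4 := hp (Ne.symm hw)
      have h5 := hp (Ne.symm hv)
      simp only [hv, hw, if_false, affinize]
      rw [bracket, crossRatio, crossRatio, hκ]
      field_simp
      simp only [bracket]
      ring

lemma crossRatio_eq_of_infinity (hp : IsGeneral p) {b₁ b₂ b₃ : V} (h₁₂ : b₁ ≠ b₂)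
    (h₁₃ : b₁ ≠ b₃) (h₂₃ : b₂ ≠ b₃) {x y z : V} (hx : x ≠ b₁) (hy : y ≠ b₁) (hz : z ≠ b₁) :
    crossRatio p b₁ x y z = (crossRatio p b₁ b₂ b₃ x - crossRatio p b₁ b₂ b₃ z) /
      (crossRatio p b₁ b₂ b₃ x - crossRatio p b₁ b₂ b₃ y) := by
  rw [← crossRatio_affinize hp h₁₂ h₁₃ h₂₃ b₁ x y z, crossRatio]
  simp [affinize, hx, hy, hz, bracket]

lemma crossRatio_eq_of_finite (hp : IsGeneral p) {b₁ b₂ b₃ : V} (h₁₂ : b₁ ≠ b₂)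
    (h₁₃ : b₁ ≠ b₃) (h₂₃ : b₂ ≠ b₃) {w x y z : V} (hw : w ≠ b₁) (hx : x ≠ b₁) (hy : y ≠ b₁)
    (hz : z ≠ b₁) :
    crossRatio p w x y z =
      (crossRatio p b₁ b₂ b₃ w - crossRatio p b₁ b₂ b₃ y) *
        (crossRatio p b₁ b₂ b₃ x - crossRatio p b₁ b₂ b₃ z) /
      ((crossRatio p b₁ b₂ b₃ x - crossRatio p b₁ b₂ b₃ y) *
        (crossRatio p b₁ b₂ b₃ w - crossRatio p b₁ b₂ b₃ z)) := by
  rw [← crossRatio_affinize hp h₁₂ h₁₃ h₂₃ w x y z, crossRatio]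
  simp [affinize, hw, hx, hy, hz, bracket]

lemma agreeOn_of_base (hp : IsGeneral p) (hp' : IsGeneral p') {b₁ b₂ b₃ : V} (h₁₂ : b₁ ≠ b₂)
    (h₁₃ : b₁ ≠ b₃) (h₂₃ : b₂ ≠ b₃) {Z : Finset V}
    (h : ∀ v ∈ Z, crossRatio p b₁ b₂ b₃ v = crossRatio p' b₁ b₂ b₃ v) : AgreeOn p p' Z := by
  intro w hw x hx y hy z hz
  have key : ∀ v ∈ Z, affinize b₁ (crossRatio p b₁ b₂ b₃) v =
      affinize b₁ (crossRatio p' b₁ b₂ b₃) v := fun v hv => by simp [affinize, h v hv]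
  rw [← crossRatio_affinize hp h₁₂ h₁₃ h₂₃, ← crossRatio_affinize hp' h₁₂ h₁₃ h₂₃,
    crossRatio, crossRatio, key w hw, key x hx, key y hy, key z hz]

lemma AgreeOn.union (hp : IsGeneral p) (hp' : IsGeneral p') {Z Z' : Finset V}
    (h : AgreeOn p p' Z) (h' : AgreeOn p p' Z') (hc : 3 ≤ (Z ∩ Z').card) :
    AgreeOn p p' (Z ∪ Z') := by
  obtain ⟨b₁, b₂, b₃, hb₁, hb₂, hb₃, h₁₂, h₁₃, h₂₃⟩ := Finset.two_lt_card_iff.1 hc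
  rw [Finset.mem_inter] at hb₁ hb₂ hb₃
  refine agreeOn_of_base hp hp' h₁₂ h₁₃ h₂₃ fun v hv => ?_
  rcases Finset.mem_union.1 hv with hv | hv
  · exact h _ hb₁.1 _ hb₂.1 _ hb₃.1 _ hv
  · exact h' _ hb₁.2 _ hb₂.2 _ hb₃.2 _ hv

lemma AgreeOn.union_of_mem (hp : IsGeneral p) (hp' : IsGeneral p') {Z Z' : Finset V}
    (h : AgreeOn p p' Z) (h' : AgreeOn p p' Z') {b₁ b₂ b₃ : V} (h₁₂ : b₁ ≠ b₂)
    (h₁₃ : b₁ ≠ b₃) (h₂₃ : b₂ ≠ b₃) (hb₁ : b₁ ∈ Z ∧ b₁ ∈ Z') (hb₂ : b₂ ∈ Z ∧ b₂ ∈ Z')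
    (hb₃ : b₃ ∈ Z ∧ b₃ ∈ Z') : AgreeOn p p' (Z ∪ Z') :=
  h.union hp hp' h' (Finset.two_lt_card_iff.2 ⟨b₁, b₂, b₃, Finset.mem_inter.2 hb₁,
    Finset.mem_inter.2 hb₂, Finset.mem_inter.2 hb₃, h₁₂, h₁₃, h₂₃⟩)

end CrossRatio

/-- Numerators of the constant `1` and of the six anharmonic functions. -/
def anharmonicNum {R : Type*} [CommRing R] (c : Fin 7) (t : R) : R :=
  ![1, t, 1, 1 - t, 1, t - 1, t] c

/-- Denominators of the constant `1` and of the six anharmonic functions. -/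
def anharmonicDen {R : Type*} [CommRing R] (c : Fin 7) (t : R) : R :=
  ![1, 1, t, 1, 1 - t, t, t - 1] c

/-- The constant `1` (for `c = 0`) and the six anharmonic functions. -/
noncomputable def anharmonic (c : Fin 7) (t : ℂ) : ℂ :=
  anharmonicNum c t / anharmonicDen c t

section Anharmonic

lemma anharmonicDen_ne_zero (c : Fin 7) {t : ℂ} (h0 : t ≠ 0) (h1 : t ≠ 1) :
    anharmonicDen c t ≠ 0 := by
  have h2 := sub_ne_zero.2 h1
  have h3 := sub_ne_zero.2 h1.symm
  fin_cases c <;> simp [anharmonicDen, *]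

lemma anharmonic_zero (t : ℂ) : anharmonic 0 t = 1 := by
  simp [anharmonic, anharmonicNum, anharmonicDen]

lemma exists_anharmonic_inv (c : Fin 7) (hc : c ≠ 0) (t : ℂ) :
    ∃ c' ≠ 0, (anharmonic c t)⁻¹ = anharmonic c' t := by
  refine ⟨![0, 2, 1, 4, 3, 6, 5] c, ?_, ?_⟩
  · fin_cases c <;> simp_all
  · fin_cases c <;> simp [anharmonic, anharmonicNum, anharmonicDen]

lemma exists_anharmonic_one_sub (c : Fin 7) (hc : c ≠ 0) {t : ℂ} (h0 : t ≠ 0) (h1 : t ≠ 1) :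
    ∃ c' ≠ 0, 1 - anharmonic c t = anharmonic c' t := by
  have h2 := sub_ne_zero.2 h1
  have h3 := sub_ne_zero.2 h1.symm
  refine ⟨![0, 3, 5, 1, 6, 2, 4] c, ?_, ?_⟩
  · fin_cases c <;> simp_all
  · fin_cases c <;> simp [anharmonic, anharmonicNum, anharmonicDen] at hc ⊢ <;> field_simp <;> ring

lemma crossRatio_swap_left {V : Type*} (p : V → ℂ × ℂ) (w x y z : V) :
    crossRatio p x w y z = (crossRatio p w x y z)⁻¹ := by
  simp only [crossRatio, inv_div]

lemma crossRatio_swap_right {V : Type*} (p : V → ℂ × ℂ) (w x y z : V) :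
    crossRatio p w x z y = (crossRatio p w x y z)⁻¹ := by
  simp only [crossRatio, inv_div]
  rw [mul_comm (bracket (p x) (p y)), mul_comm (bracket (p x) (p z))]

lemma crossRatio_swap_middle {V : Type*} {p : V → ℂ × ℂ} (hp : IsGeneral p) {w x y z : V}
    (hxy : x ≠ y) (hwz : w ≠ z) : crossRatio p w y x z = 1 - crossRatio p w x y z := by
  have h1 := hp hxy
  have h2 := hp hwz
  rw [crossRatio, crossRatio, bracket_swap (p y) (p x), eq_sub_iff_add_eq, neg_mul, div_neg,
    neg_add_eq_sub, ← sub_div, div_eq_one_iff_eq (mul_ne_zero h1 h2)]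
  simp only [bracket]
  ring

lemma exists_anharmonic_of_perm {V : Type*} {p : V → ℂ × ℂ} (hp : IsGeneral p) {t : Fin 4 → V}
    (ht : Function.Injective t) {a : ℂ} (h0 : a ≠ 0) (h1 : a ≠ 1)
    (ha : crossRatio p (t 0) (t 1) (t 2) (t 3) = a) (σ : Equiv.Perm (Fin 4)) :
    ∃ c ≠ 0, crossRatio p (t (σ 0)) (t (σ 1)) (t (σ 2)) (t (σ 3)) = anharmonic c a := by
  induction σ using Submonoid.induction_of_closure_eq_top_right
    (Equiv.Perm.mclosure_swap_castSucc_succ 3) with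
  | one => exact ⟨1, by simp, by simp [ha, anharmonic, anharmonicNum, anharmonicDen]⟩
  | mul_right σ τ hτ ih =>
    obtain ⟨c, hc, hσ⟩ := ih
    obtain ⟨i, rfl⟩ := hτ
    have hne : ∀ {i j : Fin 4}, i ≠ j → t (σ i) ≠ t (σ j) :=
      fun h => ht.ne (σ.injective.ne h)
    fin_cases i
    · obtain ⟨c', hc', h⟩ := exists_anharmonic_inv c hc a
      exact ⟨c', hc', by rw [← h, ← hσ, ← crossRatio_swap_left]; rfl⟩
    · obtain ⟨c', hc', h⟩ := exists_anharmonic_one_sub c hc h0 h1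
      exact ⟨c', hc', by
        rw [← h, ← hσ, ← crossRatio_swap_middle hp (hne (by decide)) (hne (by decide))]; rfl⟩
    · obtain ⟨c', hc', h⟩ := exists_anharmonic_inv c hc a
      exact ⟨c', hc', by rw [← h, ← hσ, ← crossRatio_swap_right]; rfl⟩

lemma exists_anharmonic {V : Type*} {p : V → ℂ × ℂ} (hp : IsGeneral p) {t : Fin 4 → V}
    (ht : Function.Injective t) {a : ℂ} (h0 : a ≠ 0) (h1 : a ≠ 1)
    (ha : crossRatio p (t 0) (t 1) (t 2) (t 3) = a) {s : Fin 4 → V}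
    (hs : Function.Injective s) (hst : ∀ i, ∃ j, t j = s i) :
    ∃ c ≠ 0, crossRatio p (s 0) (s 1) (s 2) (s 3) = anharmonic c a := by
  choose f hf using hst
  have hfi : Function.Injective f := fun i j h => hs (by rw [← hf, ← hf, h])
  obtain ⟨c, hc, h⟩ := exists_anharmonic_of_perm hp ht h0 h1 ha
    (Equiv.ofBijective f (Finite.injective_iff_bijective.1 hfi))
  exact ⟨c, hc, by simpa [hf] using h⟩

/-- Multiplicative independence of anharmonic functions of distinct variables. -/
lemma exists_polynomial_anharmonic_mul_ne_one {n : ℕ} :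
    ∃ q : MvPolynomial (Fin n) ℂ, q ≠ 0 ∧ ∀ a : Fin n → ℂ, (∀ i, a i ≠ 0 ∧ a i ≠ 1) →
      MvPolynomial.eval a q ≠ 0 → ∀ i : Fin 4 → Fin n, Function.Injective i →
        ∀ c : Fin 4 → Fin 7, c 0 ≠ 0 → ∏ s, anharmonic (c s) (a (i s)) ≠ 1 := by
  let F (x : (Fin 4 → Fin n) × (Fin 4 → Fin 7)) : MvPolynomial (Fin n) ℂ :=
    ∏ s, anharmonicNum (x.2 s) (MvPolynomial.X (x.1 s)) -
      ∏ s, anharmonicDen (x.2 s) (MvPolynomial.X (x.1 s))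
  have hN (a : Fin n → ℂ) (c j) : MvPolynomial.eval a
      (anharmonicNum c (MvPolynomial.X j)) = anharmonicNum c (a j) := by
    fin_cases c <;> simp [anharmonicNum]
  have hD (a : Fin n → ℂ) (c j) : MvPolynomial.eval a
      (anharmonicDen c (MvPolynomial.X j)) = anharmonicDen c (a j) := by
    fin_cases c <;> simp [anharmonicDen]
  have hF (a : Fin n → ℂ) (x) : MvPolynomial.eval a (F x) =
      ∏ s, anharmonicNum (x.2 s) (a (x.1 s)) - ∏ s, anharmonicDen (x.2 s) (a (x.1 s)) := by
    simp only [F, map_sub, map_prod, hN, hD]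
  refine ⟨∏ x with Function.Injective x.1 ∧ x.2 0 ≠ 0, F x, ?_, ?_⟩
  · refine Finset.prod_ne_zero_iff.2 fun x hx hx0 => ?_
    obtain ⟨hi, hc⟩ := (Finset.mem_filter.1 hx).2
    have hd2 (c) : anharmonicDen c (2 : ℂ) ≠ 0 :=
      anharmonicDen_ne_zero c (by norm_num) (by norm_num)
    have hn2 (c) : anharmonicNum c (2 : ℂ) ≠ 0 := by
      fin_cases c <;> norm_num [anharmonicNum]
    have hr : ∃ r : ℂ, (anharmonicNum (x.2 0) r = 0 ∧ anharmonicDen (x.2 0) r ≠ 0) ∨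
        (anharmonicNum (x.2 0) r ≠ 0 ∧ anharmonicDen (x.2 0) r = 0) := by
      generalize x.2 0 = c at hc
      refine ⟨![0, 0, 0, 1, 1, 1, 0] c, ?_⟩
      fin_cases c <;> simp [anharmonicNum, anharmonicDen] at hc ⊢
    obtain ⟨r, hr⟩ := hr
    have h := hF (Function.update (fun _ => 2) (x.1 0) r) x
    have hs (s : Fin 3) : Function.update (fun _ => (2 : ℂ)) (x.1 0) r (x.1 s.succ) = 2 := by
      rw [Function.update_of_ne (hi.ne (Fin.succ_ne_zero s))]
    rw [hx0, map_zero, Fin.prod_univ_succ (n := 3), Fin.prod_univ_succ (n := 3)] at h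
    simp only [hs, Function.update_self] at h
    rcases hr with ⟨h1, h2⟩ | ⟨h1, h2⟩
    · rw [h1, zero_mul, zero_sub, eq_comm, neg_eq_zero] at h
      exact mul_ne_zero h2 (Finset.prod_ne_zero_iff.2 fun _ _ => hd2 _) h
    · rw [h2, zero_mul, sub_zero, eq_comm] at h
      exact mul_ne_zero h1 (Finset.prod_ne_zero_iff.2 fun _ _ => hn2 _) h
  · intro a ha hq i hi c hc h
    rw [map_prod, Finset.prod_ne_zero_iff] at hq
    refine hq (i, c) (Finset.mem_filter.2 ⟨Finset.mem_univ _, hi, hc⟩) ?_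
    have hd : ∏ s, anharmonicDen (c s) (a (i s)) ≠ 0 :=
      Finset.prod_ne_zero_iff.2 fun s _ => anharmonicDen_ne_zero _ (ha _).1 (ha _).2
    simp only [anharmonic, Finset.prod_div_distrib] at h
    rw [hF, sub_eq_zero]
    exact (div_eq_one_iff_eq hd).1 h

end Anharmonic

section Cycles

lemma exists_eq_of_quadratic {A B C : ℂ} {X : Fin 3 → ℂ}
    (h : ∀ s, A * X s ^ 2 + B * X s + C = 0) (hAB : A ≠ 0 ∨ B ≠ 0) :
    ∃ s t, s ≠ t ∧ X s = X t := by
  by_contra! hne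
  have h01 := sub_ne_zero.2 (hne 0 1 (by decide))
  have h02 := sub_ne_zero.2 (hne 0 2 (by decide))
  have h12 := sub_ne_zero.2 (hne 1 2 (by decide))
  have e1 : A * (X 0 + X 1) + B = 0 :=
    mul_left_cancel₀ h01 (by linear_combination h 0 - h 1)
  have e2 : A * (X 0 + X 2) + B = 0 :=
    mul_left_cancel₀ h02 (by linear_combination h 0 - h 2)
  have hA : A = 0 := mul_left_cancel₀ h12 (by linear_combination e1 - e2)
  exact hAB.elim (· hA) (· (by simpa [hA] using e1))

variable {V : Type*} [DecidableEq V] {P : Fin 3 → V → ℂ × ℂ}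

/-- Given common positions on `Z`, two tuples with the same two further members leave at most
two possibilities for these. -/
lemma exists_agreeOn_of_two_cycle (hP : ∀ s, IsGeneral (P s)) {Z E E' : Finset V}
    (hZ : ∀ s t, AgreeOn (P s) (P t) Z) (hE : ∀ s t, AgreeOn (P s) (P t) E)
    (hE' : ∀ s t, AgreeOn (P s) (P t) E') {u v α β γ δ : V} (huv : u ≠ v) (hu : u ∉ Z)
    (hv : v ∉ Z) (hα : α ∈ Z) (hβ : β ∈ Z) (hγ : γ ∈ Z) (hδ : δ ∈ Z) (hαβ : α ≠ β)
    (hγδ : γ ≠ δ) (hαδ : α ≠ δ) (hβδ : β ≠ δ) (hsub : {u, v, α, β} ⊆ E)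
    (hsub' : {u, v, γ, δ} ⊆ E') : ∃ s t, s ≠ t ∧ AgreeOn (P s) (P t) (Z ∪ E ∪ E') := by
  wlog hγβ : γ ≠ β generalizing α β
  · rw [not_not] at hγβ
    refine this hβ hα hαβ.symm hβδ hαδ (fun t ht => hsub ?_) (hγβ ▸ hαβ.symm)
    simp only [Finset.mem_insert, Finset.mem_singleton] at ht ⊢
    tauto
  simp only [Finset.insert_subset_iff, Finset.singleton_subset_iff] at hsub hsub'
  obtain ⟨huE, hvE, hαE, hβE⟩ := hsub
  obtain ⟨huE', hvE', hγE', hδE'⟩ := hsub'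
  have hne : ∀ t ∈ Z, u ≠ t ∧ v ≠ t := fun t ht => ⟨by rintro rfl; exact hu ht,
    by rintro rfl; exact hv ht⟩
  have huα := (hne α hα).1
  have hvα := (hne α hα).2
  have huβ := (hne β hβ).1
  have hvβ := (hne β hβ).2
  have huγ := (hne γ hγ).1
  have hvγ := (hne γ hγ).2
  have huδ := (hne δ hδ).1
  have hvδ := (hne δ hδ).2
  have key : ∃ s t, s ≠ t ∧ crossRatio (P s) α β δ u = crossRatio (P t) α β δ u := by
    set m := crossRatio (P 0) α β u v with hm
    set m' := crossRatio (P 0) γ δ u v with hm'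
    have hm0 : m ≠ 0 := crossRatio_ne_zero (hP 0) huα.symm hvβ.symm huβ.symm hvα.symm
    have hm1 : m' ≠ 1 := crossRatio_ne_one (hP 0) hγδ huδ.symm hvγ.symm huv
    have hX0 s : crossRatio (P s) α β δ β = 0 := crossRatio_base_zero _ _ _
    have hX1 s : crossRatio (P s) α β δ δ = 1 := crossRatio_base_one (hP s) hαδ hβδ
    have hinj s {x y : V} (hx : x ≠ α) (hy : y ≠ α) (hxy : x ≠ y) :=
      sub_ne_zero.2 (crossRatio_base_injective (hP s) hαδ hβδ hαβ hx hy hxy)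
    have hvu s : crossRatio (P s) α β δ v = m * crossRatio (P s) α β δ u := by
      have h := (hE s 0 α hαE β hβE u huE v hvE)
      have h1 := hinj s hαβ.symm huα huβ.symm
      rw [crossRatio_eq_of_infinity (hP s) hαβ hαδ hβδ hαβ.symm huα hvα, ← hm,
        div_eq_iff h1, hX0] at h
      linear_combination -h
    have hm's s : crossRatio (P s) γ δ u v = m' := hE' s 0 γ hγE' δ hδE' u huE' v hvE'
    by_cases hγα : γ = α
    · refine exists_eq_of_quadratic (A := 0) (B := m' - m) (C := 1 - m') (fun s => ?_) ?_
      · have h := hm's s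
        have h1 := hinj s hαδ.symm huα huδ.symm
        rw [hγα, crossRatio_eq_of_infinity (hP s) hαβ hαδ hβδ hαδ.symm huα hvα,
          div_eq_iff h1, hX1, hvu] at h
        linear_combination h
      · refine Or.inr fun h => ?_
        have h1 := hm's 0
        have h2 := hinj 0 hαδ.symm huα huδ.symm
        rw [hγα, crossRatio_eq_of_infinity (hP 0) hαβ hαδ hβδ hαδ.symm huα hvα,
          div_eq_iff h2, hX1, hvu] at h1
        exact hm1 (by linear_combination -h1 + h * crossRatio (P 0) α β δ u)
    · refine exists_eq_of_quadratic (A := m * (1 - m'))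
        (B := m' * (m + crossRatio (P 0) α β δ γ) - 1 - m * crossRatio (P 0) α β δ γ)
        (C := crossRatio (P 0) α β δ γ * (1 - m'))
        (fun s => ?_) (Or.inl (mul_ne_zero hm0 (sub_ne_zero.2 hm1.symm)))
      have h := hm's s
      have h1 := hinj s hαδ.symm huα huδ.symm
      have h2 := hinj s hγα hvα hvγ.symm
      rw [crossRatio_eq_of_finite (hP s) hαβ hαδ hβδ hγα hαδ.symm huα hvα,
        div_eq_iff (mul_ne_zero h1 h2), hX1, hvu, hZ s 0 α hα β hβ δ hδ γ hγ] at h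
      linear_combination h
  obtain ⟨s, t, hst, h⟩ := key
  refine ⟨s, t, hst, ?_⟩
  have h1 : AgreeOn (P s) (P t) (insert u Z) :=
    agreeOn_of_base (hP s) (hP t) hαβ hαδ hβδ fun x hx => by
      rcases Finset.mem_insert.1 hx with rfl | hx
      · exact h
      · exact hZ s t _ hα _ hβ _ hδ _ hx
  have h2 := h1.union_of_mem (hP s) (hP t) (hE s t) huα huβ hαβ ⟨by simp, huE⟩
    ⟨by simp [hα], hαE⟩ ⟨by simp [hβ], hβE⟩
  have h3 := h2.union_of_mem (hP s) (hP t) (hE' s t) huγ huδ hγδ ⟨by simp, huE'⟩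
    ⟨by simp [hγ], hγE'⟩ ⟨by simp [hδ], hδE'⟩
  refine h3.mono fun x hx => ?_
  simp only [Finset.mem_union, Finset.mem_insert] at hx ⊢
  tauto

/-- Four tuples that impose a closed chain of Möbius relations on `x`, `y`, `w`, `z`, with fixed
points among the three base points `A`, `B`, `C`. -/
lemma exists_agreeOn_of_four_cycle (hP : ∀ s, IsGeneral (P s)) {E₁ E₂ E₃ E₄ : Finset V}
    (hE₁ : ∀ s t, AgreeOn (P s) (P t) E₁) (hE₂ : ∀ s t, AgreeOn (P s) (P t) E₂)
    (hE₃ : ∀ s t, AgreeOn (P s) (P t) E₃) (hE₄ : ∀ s t, AgreeOn (P s) (P t) E₄)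
    {A B C D x y z w : V} (hnd : [A, B, C, x, y, z, w].Nodup) (hD : D = A ∨ D = B)
    (h₁ : {A, B, x, y} ⊆ E₁) (h₂ : {A, B, z, w} ⊆ E₂) (h₃ : {A, C, x, z} ⊆ E₃)
    (h₄ : {D, C, y, w} ⊆ E₄)
    (hgen : D = A → crossRatio (P 0) A B x y * crossRatio (P 0) A C y w ≠
      crossRatio (P 0) A B z w * crossRatio (P 0) A C x z) :
    ∃ s t, s ≠ t ∧ AgreeOn (P s) (P t) (E₁ ∪ E₂ ∪ E₃ ∪ E₄) := by
  simp only [Finset.insert_subset_iff, Finset.singleton_subset_iff] at h₁ h₂ h₃ h₄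
  obtain ⟨hA1, hB1, hx1, hy1⟩ := h₁
  obtain ⟨hA2, hB2, hz2, hw2⟩ := h₂
  obtain ⟨hA3, hC3, hx3, hz3⟩ := h₃
  obtain ⟨hD4, hC4, hy4, hw4⟩ := h₄
  simp only [List.nodup_cons, List.mem_cons, List.not_mem_nil, or_false, not_or, not_false_iff,
    List.nodup_nil, and_true] at hnd
  obtain ⟨⟨hAB, hAC, hAx, hAy, hAz, hAw⟩, ⟨hBC, hBx, hBy, hBz, hBw⟩, ⟨hCx, hCy, hCz, hCw⟩,
    ⟨hxy, hxz, hxw⟩, ⟨hyz, hyw⟩, hzw⟩ := hnd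
  have key : ∃ s t, s ≠ t ∧ crossRatio (P s) A B C x = crossRatio (P t) A B C x := by
    set m₁ := crossRatio (P 0) A B x y with hm₁
    set m₂ := crossRatio (P 0) A B z w with hm₂
    set m₃ := crossRatio (P 0) A C x z with hm₃
    have hm₁0 : m₁ ≠ 0 := crossRatio_ne_zero (hP 0) hAx hBy hBx hAy
    have hm₂0 : m₂ ≠ 0 := crossRatio_ne_zero (hP 0) hAz hBw hBz hAw
    have hm₃0 : m₃ ≠ 0 := crossRatio_ne_zero (hP 0) hAx hCz hCx hAz
    have hX0 s : crossRatio (P s) A B C B = 0 := crossRatio_base_zero _ _ _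
    have hX1 s : crossRatio (P s) A B C C = 1 := crossRatio_base_one (hP s) hAC hBC
    have hinj s {a b : V} (ha : A ≠ a) (hb : A ≠ b) (hab : a ≠ b) :=
      sub_ne_zero.2 (crossRatio_base_injective (hP s) hAC hBC hAB ha.symm hb.symm hab)
    have hy s : crossRatio (P s) A B C y = m₁ * crossRatio (P s) A B C x := by
      have h := hE₁ s 0 A hA1 B hB1 x hx1 y hy1
      rw [crossRatio_eq_of_infinity (hP s) hAB hAC hBC (Ne.symm hAB) (Ne.symm hAx) (Ne.symm hAy),
        ← hm₁, div_eq_iff (hinj s hAB hAx hBx), hX0] at h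
      linear_combination -h
    have hw s : crossRatio (P s) A B C w = m₂ * crossRatio (P s) A B C z := by
      have h := hE₂ s 0 A hA2 B hB2 z hz2 w hw2
      rw [crossRatio_eq_of_infinity (hP s) hAB hAC hBC (Ne.symm hAB) (Ne.symm hAz) (Ne.symm hAw),
        ← hm₂, div_eq_iff (hinj s hAB hAz hBz), hX0] at h
      linear_combination -h
    have hz s : crossRatio (P s) A B C z = 1 - m₃ + m₃ * crossRatio (P s) A B C x := by
      have h := hE₃ s 0 A hA3 C hC3 x hx3 z hz3
      rw [crossRatio_eq_of_infinity (hP s) hAB hAC hBC (Ne.symm hAC) (Ne.symm hAx) (Ne.symm hAz),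
        ← hm₃, div_eq_iff (hinj s hAC hAx hCx), hX1] at h
      linear_combination -h
    rcases hD with rfl | rfl
    · set m₄ := crossRatio (P 0) D C y w with hm₄
      refine exists_eq_of_quadratic (A := 0) (B := m₁ * m₄ - m₂ * m₃)
        (C := 1 - m₂ + m₂ * m₃ - m₄) (fun s => ?_) (Or.inr (sub_ne_zero.2 (hgen rfl)))
      have h := hE₄ s 0 D hD4 C hC4 y hy4 w hw4
      rw [crossRatio_eq_of_infinity (hP s) hAB hAC hBC (Ne.symm hAC) (Ne.symm hAy) (Ne.symm hAw),
        ← hm₄, div_eq_iff (hinj s hAC hAy hCy), hX1, hy, hw, hz] at h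
      linear_combination h
    · set m₄ := crossRatio (P 0) D C y w with hm₄
      have hm₄1 : m₄ ≠ 1 := crossRatio_ne_one (hP 0) hBC hCy hBw hyw
      refine exists_eq_of_quadratic (A := m₁ * m₂ * m₃ * (m₄ - 1))
        (B := m₁ * (1 - m₂ * (1 - m₃)) - m₄ * (m₂ * m₃ - m₁ * (m₂ * (1 - m₃))))
        (C := -m₄ * (m₂ * (1 - m₃))) (fun s => ?_)
        (Or.inl (mul_ne_zero (mul_ne_zero (mul_ne_zero hm₁0 hm₂0) hm₃0) (sub_ne_zero.2 hm₄1)))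
      have h := hE₄ s 0 D hD4 C hC4 y hy4 w hw4
      rw [crossRatio_eq_of_finite (hP s) hAB hAC hBC (Ne.symm hAB) (Ne.symm hAC) (Ne.symm hAy)
        (Ne.symm hAw), ← hm₄,
        div_eq_iff (mul_ne_zero (hinj s hAC hAy hCy) (hinj s hAB hAw hBw)), hX0, hX1, hy, hw,
        hz] at h
      linear_combination -h
  obtain ⟨s, t, hst, h⟩ := key
  refine ⟨s, t, hst, ?_⟩
  have h0 : AgreeOn (P s) (P t) {A, B, C, x} :=
    agreeOn_of_base (hP s) (hP t) hAB hAC hBC fun v hv => by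
      simp only [Finset.mem_insert, Finset.mem_singleton] at hv
      rcases hv with rfl | rfl | rfl | rfl
      · simp [crossRatio, bracket_self]
      · rw [crossRatio_base_zero, crossRatio_base_zero]
      · rw [crossRatio_base_one (hP s) hAC hBC, crossRatio_base_one (hP t) hAC hBC]
      · exact h
  have h1 := h0.union_of_mem (hP s) (hP t) (hE₁ s t) hAB hAx hBx ⟨by simp, hA1⟩ ⟨by simp, hB1⟩
    ⟨by simp, hx1⟩
  have h2 := h1.union_of_mem (hP s) (hP t) (hE₃ s t) hAC hAx hCx ⟨by simp, hA3⟩ ⟨by simp, hC3⟩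
    ⟨by simp, hx3⟩
  have h3 := h2.union_of_mem (hP s) (hP t) (hE₂ s t) hAB hAz hBz ⟨by simp, hA2⟩ ⟨by simp, hB2⟩
    ⟨by simp [hz3], hz2⟩
  have h4 := h3.union_of_mem (hP s) (hP t) (hE₄ s t) hCy hCw hyw ⟨by simp, hC4⟩
    ⟨by simp [hy1], hy4⟩ ⟨by simp [hw2], hw4⟩
  refine h4.mono fun v hv => ?_
  simp only [Finset.mem_union] at hv ⊢
  tauto

end Cycles

section Combinatorics

variable {V : Type*} [DecidableEq V] {P : Fin 3 → V → ℂ × ℂ}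

lemma exists_agreeOn_of_card_sdiff_eq_two (hP : ∀ s, IsGeneral (P s)) {Y Z E E' : Finset V}
    (hY : (Y \ Z).card = 2) (hE : E.card = 4) (hE' : E'.card = 4) (hEY : E ⊆ Y) (hEY' : E' ⊆ Y)
    (hne : E ≠ E') (hEZ : (E ∩ Z).card ≤ 2) (hEZ' : (E' ∩ Z).card ≤ 2)
    (aZ : ∀ s t, AgreeOn (P s) (P t) Z) (aE : ∀ s t, AgreeOn (P s) (P t) E)
    (aE' : ∀ s t, AgreeOn (P s) (P t) E') : ∃ s t, s ≠ t ∧ AgreeOn (P s) (P t) (Z ∪ E ∪ E') := by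
  have key {F : Finset V} (hF : F.card = 4) (hFY : F ⊆ Y) (hFZ : (F ∩ Z).card ≤ 2) :
      F \ Z = Y \ Z ∧ (F ∩ Z).card = 2 := by
    have h1 := Finset.card_sdiff_add_card_inter F Z
    have h2 : F \ Z ⊆ Y \ Z := Finset.sdiff_subset_sdiff hFY le_rfl
    have h3 := Finset.card_le_card h2
    exact ⟨Finset.eq_of_subset_of_card_le h2 (by omega), by omega⟩
  obtain ⟨hd, hc⟩ := key hE hEY hEZ
  obtain ⟨hd', hc'⟩ := key hE' hEY' hEZ'
  obtain ⟨u, v, huv, hUV⟩ := Finset.card_eq_two.1 hY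
  have hmem : ∀ t ∈ Y \ Z, t ∈ E ∧ t ∈ E' ∧ t ∉ Z := fun t ht =>
    ⟨(Finset.mem_sdiff.1 (hd ▸ ht)).1, (Finset.mem_sdiff.1 (hd' ▸ ht)).1,
      (Finset.mem_sdiff.1 ht).2⟩
  have hu := hmem u (by simp [hUV])
  have hv := hmem v (by simp [hUV])
  have hnsub : ¬ E' ∩ Z ⊆ E ∩ Z := fun h => hne <| by
    rw [← Finset.sdiff_union_inter E Z, ← Finset.sdiff_union_inter E' Z, hd, hd',
      Finset.eq_of_subset_of_card_le h (by omega)]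
  obtain ⟨δ, hδ, hδE⟩ := Finset.not_subset.1 hnsub
  obtain ⟨γ, hγ, hγδ⟩ := Finset.exists_mem_ne (by omega : 1 < (E' ∩ Z).card) δ
  obtain ⟨α, β, hαβ, hAB⟩ := Finset.card_eq_two.1 hc
  have hα : α ∈ E ∩ Z := by simp [hAB]
  have hβ : β ∈ E ∩ Z := by simp [hAB]
  have hαδ : α ≠ δ := by rintro rfl; exact hδE hα
  have hβδ : β ≠ δ := by rintro rfl; exact hδE hβ
  rw [Finset.mem_inter] at hα hβ hγ hδ
  refine exists_agreeOn_of_two_cycle hP aZ aE aE' huv hu.2.2 hv.2.2 hα.2 hβ.2 hγ.2 hδ.2 hαβ hγδ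
    hαδ hβδ ?_ ?_ <;>
  simp only [Finset.insert_subset_iff, Finset.singleton_subset_iff] <;> tauto

lemma card_inter_regions {E E₁ E₂ : Finset V} {C : V} (hE : E.card = 4) (hC : C ∈ E)
    (hC₁ : C ∉ E₁) (hC₂ : C ∉ E₂) (hsub : E ⊆ insert C (E₁ ∪ E₂)) :
    (E ∩ (E₁ ∩ E₂)).card + (E ∩ (E₁ \ E₂)).card + (E ∩ (E₂ \ E₁)).card = 3 ∧
      (E ∩ E₁).card = (E ∩ (E₁ ∩ E₂)).card + (E ∩ (E₁ \ E₂)).card ∧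
      (E ∩ E₂).card = (E ∩ (E₁ ∩ E₂)).card + (E ∩ (E₂ \ E₁)).card := by
  have h1 : (E ∩ E₁).card = (E ∩ (E₁ ∩ E₂)).card + (E ∩ (E₁ \ E₂)).card := by
    rw [← Finset.card_union_of_disjoint]
    · congr 1; ext; simp only [Finset.mem_inter, Finset.mem_union, Finset.mem_sdiff]; tauto
    · rw [Finset.disjoint_left]; simp only [Finset.mem_inter, Finset.mem_sdiff]; tauto
  have h2 : (E ∩ E₂).card = (E ∩ (E₁ ∩ E₂)).card + (E ∩ (E₂ \ E₁)).card := by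
    rw [← Finset.card_union_of_disjoint]
    · congr 1; ext; simp only [Finset.mem_inter, Finset.mem_union, Finset.mem_sdiff]; tauto
    · rw [Finset.disjoint_left]; simp only [Finset.mem_inter, Finset.mem_sdiff]; tauto
  have h3 : (E.erase C).card = (E ∩ E₁).card + (E ∩ (E₂ \ E₁)).card := by
    rw [← Finset.card_union_of_disjoint]
    · congr 1
      ext t
      have ht := @hsub t
      simp only [Finset.mem_inter, Finset.mem_union, Finset.mem_sdiff, Finset.mem_erase,
        Finset.mem_insert] at ht ⊢
      constructor
      · tauto
      · rintro (⟨h, h'⟩ | ⟨h, h', -⟩)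
        · exact ⟨by rintro rfl; exact hC₁ h', h⟩
        · exact ⟨by rintro rfl; exact hC₂ h', h⟩
    · rw [Finset.disjoint_left]; simp only [Finset.mem_inter, Finset.mem_sdiff]; tauto
  rw [Finset.card_erase_of_mem hC] at h3
  omega

/-- Two tuples with three common members. -/
lemma exists_agreeOn_of_card_inter_eq_three (hP : ∀ s, IsGeneral (P s))
    {E₁ E₂ E₃ E₄ : Finset V} (c₁ : E₁.card = 4) (c₂ : E₂.card = 4) (c₃ : E₃.card = 4)
    (c₄ : E₄.card = 4) (aE₁ : ∀ s t, AgreeOn (P s) (P t) E₁)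
    (aE₂ : ∀ s t, AgreeOn (P s) (P t) E₂) (aE₃ : ∀ s t, AgreeOn (P s) (P t) E₃)
    (aE₄ : ∀ s t, AgreeOn (P s) (P t) E₄) (hY : (E₁ ∪ E₂ ∪ E₃ ∪ E₄).card = 7)
    (h₁₂ : (E₁ ∩ E₂).card = 3) (h₃₄ : E₃ ≠ E₄) (h₁₂₃ : 6 ≤ (E₁ ∪ E₂ ∪ E₃).card)
    (h₁₂₄ : 6 ≤ (E₁ ∪ E₂ ∪ E₄).card) :
    ∃ s t, s ≠ t ∧ AgreeOn (P s) (P t) (E₁ ∪ E₂ ∪ E₃ ∪ E₄) := by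
  have aZ s t : AgreeOn (P s) (P t) (E₁ ∪ E₂) := (aE₁ s t).union (hP s) (hP t) (aE₂ s t) h₁₂.ge
  have hZ := Finset.card_union_add_card_inter E₁ E₂
  have h3 := Finset.card_union_add_card_inter (E₁ ∪ E₂) E₃
  have h4 := Finset.card_union_add_card_inter (E₁ ∪ E₂) E₄
  have h34 := Finset.card_union_add_card_inter (E₁ ∪ E₂ ∪ E₃) E₄
  have h43 := Finset.card_union_add_card_inter (E₁ ∪ E₂ ∪ E₄) E₃
  rw [Finset.union_right_comm] at h43
  by_cases h : 3 ≤ ((E₁ ∪ E₂) ∩ E₃).card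
  · exact ⟨0, 1, by decide, ((aZ 0 1).union (hP 0) (hP 1) (aE₃ 0 1) h).union (hP 0) (hP 1)
      (aE₄ 0 1) (by omega)⟩
  by_cases h' : 3 ≤ ((E₁ ∪ E₂) ∩ E₄).card
  · rw [Finset.union_right_comm]
    exact ⟨0, 1, by decide, ((aZ 0 1).union (hP 0) (hP 1) (aE₄ 0 1) h').union (hP 0) (hP 1)
      (aE₃ 0 1) (by omega)⟩
  refine exists_agreeOn_of_card_sdiff_eq_two (Y := E₁ ∪ E₂ ∪ E₃ ∪ E₄) hP ?_ c₃ c₄ ?_ ?_ h₃₄ ?_ ?_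
    aZ aE₃ aE₄
  · rw [Finset.card_sdiff_of_subset (fun x hx => by
      simp only [Finset.mem_union] at hx ⊢; tauto)]
    omega
  · exact fun x hx => by
      simp only [Finset.mem_union] at hx ⊢; tauto
  · exact fun x hx => by
      simp only [Finset.mem_union] at hx ⊢; tauto
  · rw [Finset.inter_comm]; omega
  · rw [Finset.inter_comm]; omega

/-- Three tuples on six vertices, pairwise with two common members. -/
lemma exists_agreeOn_of_card_union_le_six (hP : ∀ s, IsGeneral (P s))
    {E₁ E₂ E₃ E₄ : Finset V} (c₁ : E₁.card = 4) (c₂ : E₂.card = 4) (c₃ : E₃.card = 4)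
    (c₄ : E₄.card = 4) (aE₁ : ∀ s t, AgreeOn (P s) (P t) E₁)
    (aE₂ : ∀ s t, AgreeOn (P s) (P t) E₂) (aE₃ : ∀ s t, AgreeOn (P s) (P t) E₃)
    (aE₄ : ∀ s t, AgreeOn (P s) (P t) E₄) (hY : (E₁ ∪ E₂ ∪ E₃ ∪ E₄).card = 7)
    (h₁₂ : (E₁ ∩ E₂).card ≤ 2) (h₁₃ : (E₁ ∩ E₃).card ≤ 2) (h₂₃ : E₂ ≠ E₃)
    (h : (E₁ ∪ E₂ ∪ E₃).card ≤ 6) :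
    ∃ s t, s ≠ t ∧ AgreeOn (P s) (P t) (E₁ ∪ E₂ ∪ E₃ ∪ E₄) := by
  have h1 := Finset.card_union_add_card_inter E₁ E₂
  have h2 := Finset.card_le_card (Finset.subset_union_left : E₁ ∪ E₂ ⊆ E₁ ∪ E₂ ∪ E₃)
  have h3 := Finset.card_union_add_card_inter (E₁ ∪ E₂ ∪ E₃) E₄
  obtain ⟨s, t, hst, hs⟩ := exists_agreeOn_of_card_sdiff_eq_two (Y := E₁ ∪ E₂ ∪ E₃) (Z := E₁) hP
    (by rw [Finset.card_sdiff_of_subset (fun x hx => by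
      simp only [Finset.mem_union] at hx ⊢; tauto)]; omega) c₂ c₃
    (fun x hx => by
      simp only [Finset.mem_union] at hx ⊢; tauto) (fun x hx => by
      simp only [Finset.mem_union] at hx ⊢; tauto) h₂₃ (by rwa [Finset.inter_comm])
    (by rwa [Finset.inter_comm]) aE₁ aE₂ aE₃
  exact ⟨s, t, hst, hs.union (hP s) (hP t) (aE₄ s t) (by omega)⟩

/-- Four tuples, pairwise with at most two common members, such that every three of them cover all
vertices. -/
lemma exists_agreeOn_of_three_cover (hP : ∀ s, IsGeneral (P s))
    {Y E₁ E₂ E₃ E₄ : Finset V} (c₁ : E₁.card = 4) (c₂ : E₂.card = 4) (c₃ : E₃.card = 4)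
    (c₄ : E₄.card = 4) (aE₁ : ∀ s t, AgreeOn (P s) (P t) E₁)
    (aE₂ : ∀ s t, AgreeOn (P s) (P t) E₂) (aE₃ : ∀ s t, AgreeOn (P s) (P t) E₃)
    (aE₄ : ∀ s t, AgreeOn (P s) (P t) E₄) (hY : Y.card = 7)
    (h₁₂₃ : E₁ ∪ E₂ ∪ E₃ = Y) (h₁₂₄ : E₁ ∪ E₂ ∪ E₄ = Y) (h₁₃₄ : E₁ ∪ E₃ ∪ E₄ = Y)
    (h₂₃₄ : E₂ ∪ E₃ ∪ E₄ = Y) (i₁₂ : (E₁ ∩ E₂).card ≤ 2)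
    (i₁₃ : (E₃ ∩ E₁).card ≤ 2) (i₁₄ : (E₄ ∩ E₁).card ≤ 2) (i₂₃ : (E₃ ∩ E₂).card ≤ 2)
    (i₂₄ : (E₄ ∩ E₂).card ≤ 2) (m₁₂ : (E₃ ∩ E₄).card ≤ (E₁ ∩ E₂).card)
    (m₁₃ : (E₃ ∩ E₄).card ≤ (E₃ ∩ E₁).card) (m₁₄ : (E₃ ∩ E₄).card ≤ (E₄ ∩ E₁).card)
    (m₂₃ : (E₃ ∩ E₄).card ≤ (E₃ ∩ E₂).card) (m₂₄ : (E₃ ∩ E₄).card ≤ (E₄ ∩ E₂).card)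
    (hgen : ∀ A B C x y z w, [A, B, C, x, y, z, w].Nodup → {A, B, x, y} ⊆ E₁ →
      {A, B, z, w} ⊆ E₂ → {A, C, x, z} ⊆ E₃ → {A, C, y, w} ⊆ E₄ →
      crossRatio (P 0) A B x y * crossRatio (P 0) A C y w ≠
        crossRatio (P 0) A B z w * crossRatio (P 0) A C x z) :
    ∃ s t, s ≠ t ∧ AgreeOn (P s) (P t) (E₁ ∪ E₂ ∪ E₃ ∪ E₄) := by
  have sub₁ : E₁ ⊆ Y := fun t ht => h₁₂₃ ▸ by simp [ht]
  have sub₂ : E₂ ⊆ Y := fun t ht => h₁₂₃ ▸ by simp [ht]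
  have sub₃ : E₃ ⊆ Y := fun t ht => h₁₂₃ ▸ by simp [ht]
  have sub₄ : E₄ ⊆ Y := fun t ht => h₁₂₄ ▸ by simp [ht]
  have mem {E F G : Finset V} (h : E ∪ F ∪ G = Y) {t : V} (ht : t ∈ Y) :
      t ∈ E ∨ t ∈ F ∨ t ∈ G := by
    rw [← h] at ht
    simpa only [Finset.mem_union, or_assoc] using ht
  have u₁₂ := Finset.card_union_add_card_inter E₁ E₂
  have u₃₄ := Finset.card_union_add_card_inter E₃ E₄
  have cover₃₄ (h : (E₃ ∩ E₄).card ≤ 1) : E₃ ∪ E₄ = Y :=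
    Finset.eq_of_subset_of_card_le (Finset.union_subset sub₃ sub₄) (by omega)
  have cover₁₂ (h : (E₁ ∩ E₂).card ≤ 1) : E₁ ∪ E₂ = Y :=
    Finset.eq_of_subset_of_card_le (Finset.union_subset sub₁ sub₂) (by omega)
  have d₁₂ : (E₁ ∩ E₂).card = 2 := by
    by_contra hne
    have h12 := cover₁₂ (by omega)
    have h34 := cover₃₄ (by omega)
    have empty {E : Finset V} (hE : E.card = 4) (hs : E ⊆ Y) (h1 : (E ∩ E₁).card ≤ 2)
        (h2 : (E ∩ E₂).card ≤ 2) : (E ∩ E₁) ∩ (E ∩ E₂) = ∅ := by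
      have h3 := Finset.card_union_add_card_inter (E ∩ E₁) (E ∩ E₂)
      rw [← Finset.inter_union_distrib_left, h12, Finset.inter_eq_left.2 hs] at h3
      exact Finset.card_eq_zero.1 (by omega)
    have e3 := empty c₃ sub₃ i₁₃ i₂₃
    have e4 := empty c₄ sub₄ i₁₄ i₂₄
    have h1 : (E₁ ∪ E₂).card ≤ 7 := hY ▸ Finset.card_le_card (Finset.union_subset sub₁ sub₂)
    obtain ⟨A, hA⟩ := Finset.card_pos.1 (by omega : 0 < (E₁ ∩ E₂).card)
    rw [Finset.mem_inter] at hA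
    have hAY : A ∈ E₃ ∪ E₄ := h34 ▸ sub₁ hA.1
    rcases Finset.mem_union.1 hAY with h | h
    · exact Finset.notMem_empty A (e3 ▸ by simp [h, hA])
    · exact Finset.notMem_empty A (e4 ▸ by simp [h, hA])
  have hCc : (Y \ (E₁ ∪ E₂)).card = 1 := by
    rw [Finset.card_sdiff_of_subset (Finset.union_subset sub₁ sub₂)]
    omega
  obtain ⟨C, hC⟩ := Finset.card_eq_one.1 hCc
  have hCm : C ∈ Y \ (E₁ ∪ E₂) := by simp [hC]
  simp only [Finset.mem_sdiff, Finset.mem_union, not_or] at hCm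
  obtain ⟨hCY, hC1, hC2⟩ := hCm
  have hC3 : C ∈ E₃ := by have := mem h₁₂₃ hCY; tauto
  have hC4 : C ∈ E₄ := by have := mem h₁₂₄ hCY; tauto
  have hYC : Y ⊆ insert C (E₁ ∪ E₂) := fun t ht => by
    by_cases h : t ∈ E₁ ∪ E₂
    · exact Finset.mem_insert_of_mem h
    · have : t ∈ Y \ (E₁ ∪ E₂) := Finset.mem_sdiff.2 ⟨ht, h⟩
      rw [hC, Finset.mem_singleton] at this
      simp [this]
  have r3 := card_inter_regions c₃ hC3 hC1 hC2 (sub₃.trans hYC)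
  have r4 := card_inter_regions c₄ hC4 hC1 hC2 (sub₄.trans hYC)
  have split {E E' : Finset V} (h : E ∪ E' = Y) :
      2 ≤ (E ∩ (E₁ ∩ E₂)).card + (E' ∩ (E₁ ∩ E₂)).card := by
    have h1 := Finset.card_union_le (E ∩ (E₁ ∩ E₂)) (E' ∩ (E₁ ∩ E₂))
    rwa [← Finset.union_inter_distrib_right, h,
      Finset.inter_eq_right.2 (Finset.inter_subset_left.trans sub₁), d₁₂] at h1
  have t3 : (E₃ ∩ (E₁ ∩ E₂)).card = 1 := by
    by_contra hne
    have := split (cover₃₄ (by omega))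
    omega
  have t4 : (E₄ ∩ (E₁ ∩ E₂)).card = 1 := by
    by_contra hne
    have := split (cover₃₄ (by omega))
    omega
  have pick {E F : Finset V} (h : (E ∩ F).card = 1) (hF : F.card = 2) :
      ∃ a b, a ≠ b ∧ a ∈ E ∧ b ∉ E ∧ F = {a, b} := by
    obtain ⟨a, ha⟩ := Finset.card_eq_one.1 h
    have haF : a ∈ E ∩ F := by simp [ha]
    rw [Finset.mem_inter] at haF
    obtain ⟨b, hb, hba⟩ := Finset.exists_mem_ne (by omega : 1 < F.card) a
    refine ⟨a, b, hba.symm, haF.1, fun hbE => hba ?_, ?_⟩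
    · have : b ∈ E ∩ F := Finset.mem_inter.2 ⟨hbE, hb⟩
      simpa [ha] using this
    · refine (Finset.eq_of_subset_of_card_le ?_ ?_).symm
      · simp [Finset.insert_subset_iff, haF.2, hb]
      · rw [hF, Finset.card_pair hba.symm]
  have s12 := Finset.card_sdiff_add_card_inter E₁ E₂
  have s21 := Finset.card_sdiff_add_card_inter E₂ E₁
  rw [Finset.inter_comm] at s21
  obtain ⟨A, B, hAB, hA3, hB3, hABe⟩ := pick t3 d₁₂
  obtain ⟨x, y, hxy, hx3, hy3, hxye⟩ := pick (F := E₁ \ E₂) (E := E₃) (by omega) (by omega)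
  obtain ⟨z, w, hzw, hz3, hw3, hzwe⟩ := pick (F := E₂ \ E₁) (E := E₃) (by omega) (by omega)
  obtain ⟨D, hD⟩ := Finset.card_eq_one.1 t4
  have hDm : D ∈ E₄ ∩ (E₁ ∩ E₂) := by simp [hD]
  rw [Finset.mem_inter, hABe, Finset.mem_insert, Finset.mem_singleton] at hDm
  have hAm : A ∈ E₁ ∩ E₂ := by simp [hABe]
  have hBm : B ∈ E₁ ∩ E₂ := by simp [hABe]
  have hxm : x ∈ E₁ \ E₂ := by simp [hxye]
  have hym : y ∈ E₁ \ E₂ := by simp [hxye]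
  have hzm : z ∈ E₂ \ E₁ := by simp [hzwe]
  have hwm : w ∈ E₂ \ E₁ := by simp [hzwe]
  rw [Finset.mem_inter] at hAm hBm
  rw [Finset.mem_sdiff] at hxm hym hzm hwm
  have hy4 : y ∈ E₄ := by have := mem h₂₃₄ (sub₁ hym.1); tauto
  have hw4 : w ∈ E₄ := by have := mem h₁₃₄ (sub₂ hwm.1); tauto
  have hnd : [A, B, C, x, y, z, w].Nodup := by
    simp only [List.nodup_cons, List.mem_cons, List.not_mem_nil, or_false, not_or, not_false_iff,
      List.nodup_nil, and_true]
    have ne {E : Finset V} {a b : V} (ha : a ∈ E) (hb : b ∉ E) : a ≠ b :=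
      ne_of_mem_of_not_mem ha hb
    exact ⟨⟨hAB, ne hAm.1 hC1, ne hAm.2 hxm.2, ne hAm.2 hym.2, ne hAm.1 hzm.2, ne hAm.1 hwm.2⟩,
      ⟨ne hBm.1 hC1, ne hBm.2 hxm.2, ne hBm.2 hym.2, ne hBm.1 hzm.2, ne hBm.1 hwm.2⟩,
      ⟨(ne hxm.1 hC1).symm, (ne hym.1 hC1).symm, (ne hzm.1 hC2).symm, (ne hwm.1 hC2).symm⟩,
      ⟨hxy, ne hxm.1 hzm.2, ne hxm.1 hwm.2⟩, ⟨ne hym.1 hzm.2, ne hym.1 hwm.2⟩, hzw⟩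
  have hE1 : {A, B, x, y} ⊆ E₁ := by
    simp only [Finset.insert_subset_iff, Finset.singleton_subset_iff]
    exact ⟨hAm.1, hBm.1, hxm.1, hym.1⟩
  have hE2 : {A, B, z, w} ⊆ E₂ := by
    simp only [Finset.insert_subset_iff, Finset.singleton_subset_iff]
    exact ⟨hAm.2, hBm.2, hzm.1, hwm.1⟩
  have hE3 : {A, C, x, z} ⊆ E₃ := by
    simp only [Finset.insert_subset_iff, Finset.singleton_subset_iff]
    exact ⟨hA3, hC3, hx3, hz3⟩
  have hE4 : {D, C, y, w} ⊆ E₄ := by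
    simp only [Finset.insert_subset_iff, Finset.singleton_subset_iff]
    exact ⟨hDm.1, hC4, hy4, hw4⟩
  exact exists_agreeOn_of_four_cycle hP aE₁ aE₂ aE₃ aE₄ hnd hDm.2 hE1 hE2 hE3 hE4
    fun h => hgen A B C x y z w hnd hE1 hE2 hE3 (h ▸ hE4)

lemma exists_perm_eq : ∀ i j k : Fin 4, i ≠ j → i ≠ k → j ≠ k →
    ∃ σ : Equiv.Perm (Fin 4), σ 0 = i ∧ σ 1 = j ∧ σ 2 = k := by
  decide

lemma exists_perm_zero_one : ∀ i j : Fin 4, i ≠ j →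
    ∃ σ : Equiv.Perm (Fin 4), σ 0 = i ∧ σ 1 = j := by
  decide

lemma exists_agreeOn_biUnion (hP : ∀ s, IsGeneral (P s)) {E : Fin 4 → Finset V}
    (hc : ∀ i, (E i).card = 4) (aE : ∀ i s t, AgreeOn (P s) (P t) (E i))
    (hY : (Finset.univ.biUnion E).card = 7) (hne : ∀ i j, i ≠ j → E i ≠ E j)
    (h3 : ∀ i j k, i ≠ j → i ≠ k → j ≠ k → 6 ≤ (E i ∪ E j ∪ E k).card)
    (hgen : ∀ (σ : Equiv.Perm (Fin 4)) (A B C x y z w : V), [A, B, C, x, y, z, w].Nodup →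
      {A, B, x, y} ⊆ E (σ 0) → {A, B, z, w} ⊆ E (σ 1) → {A, C, x, z} ⊆ E (σ 2) →
      {A, C, y, w} ⊆ E (σ 3) →
      crossRatio (P 0) A B x y * crossRatio (P 0) A C y w ≠
        crossRatio (P 0) A B z w * crossRatio (P 0) A C x z) :
    ∃ s t, s ≠ t ∧ AgreeOn (P s) (P t) (Finset.univ.biUnion E) := by
  have hU (σ : Equiv.Perm (Fin 4)) :
      E (σ 0) ∪ E (σ 1) ∪ E (σ 2) ∪ E (σ 3) = Finset.univ.biUnion E := by
    ext t
    simp only [Finset.mem_union, Finset.mem_biUnion, Finset.mem_univ, true_and]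
    rw [σ.surjective.exists (p := fun i => t ∈ E i)]
    simp [Fin.exists_fin_succ, or_assoc]
  have hσ (σ : Equiv.Perm (Fin 4)) {i j : Fin 4} (h : i ≠ j) : σ i ≠ σ j := σ.injective.ne h
  by_cases hA : ∃ i j, i ≠ j ∧ 3 ≤ (E i ∩ E j).card
  · obtain ⟨i, j, hij, h⟩ := hA
    obtain ⟨σ, rfl, rfl⟩ := exists_perm_zero_one i j hij
    have h4 : (E (σ 0) ∩ E (σ 1)).card ≠ 4 := fun h4 => hne _ _ hij <| by
      exact (Finset.eq_of_subset_of_card_le Finset.inter_subset_left (by rw [h4, hc])).symm.trans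
        (Finset.eq_of_subset_of_card_le Finset.inter_subset_right (by rw [h4, hc]))
    have h5 := Finset.card_le_card (Finset.inter_subset_left : E (σ 0) ∩ E (σ 1) ⊆ E (σ 0))
    rw [hc] at h5
    rw [← hU σ] at hY ⊢
    exact exists_agreeOn_of_card_inter_eq_three hP (hc _) (hc _) (hc _) (hc _) (aE _) (aE _)
      (aE _) (aE _) hY (by omega) (hne _ _ (hσ σ (by decide)))
      (h3 _ _ _ hij (hσ σ (by decide)) (hσ σ (by decide)))
      (h3 _ _ _ hij (hσ σ (by decide)) (hσ σ (by decide)))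
  have hA' : ∀ i j, i ≠ j → (E i ∩ E j).card ≤ 2 := fun i j hij => by
    by_contra h
    exact hA ⟨i, j, hij, by omega⟩
  by_cases hB : ∃ i j k, i ≠ j ∧ i ≠ k ∧ j ≠ k ∧ (E i ∪ E j ∪ E k).card ≤ 6
  · obtain ⟨i, j, k, hij, hik, hjk, h⟩ := hB
    obtain ⟨σ, rfl, rfl, rfl⟩ := exists_perm_eq i j k hij hik hjk
    rw [← hU σ] at hY ⊢
    exact exists_agreeOn_of_card_union_le_six hP (hc _) (hc _) (hc _) (hc _) (aE _) (aE _) (aE _)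
      (aE _) hY (hA' _ _ hij) (hA' _ _ hik) (hne _ _ hjk) h
  have cover (i j k) (hij : i ≠ j) (hik : i ≠ k) (hjk : j ≠ k) :
      E i ∪ E j ∪ E k = Finset.univ.biUnion E := by
    have hs i := Finset.subset_biUnion_of_mem E (Finset.mem_univ i)
    refine Finset.eq_of_subset_of_card_le
      (Finset.union_subset (Finset.union_subset (hs i) (hs j)) (hs k)) ?_
    rw [hY]
    by_contra h
    exact hB ⟨i, j, k, hij, hik, hjk, by omega⟩
  obtain ⟨σ, hmin⟩ := Finite.exists_min
    (fun σ : Equiv.Perm (Fin 4) => (E (σ 1) ∩ E (σ 0)).card)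
  have hmin' (i j) (h : i ≠ j) : (E (σ 1) ∩ E (σ 0)).card ≤ (E i ∩ E j).card := by
    obtain ⟨τ, rfl, rfl⟩ := exists_perm_zero_one j i h.symm
    exact hmin τ
  have h01 := hσ σ (show (0 : Fin 4) ≠ 1 by decide)
  have h02 := hσ σ (show (0 : Fin 4) ≠ 2 by decide)
  have h03 := hσ σ (show (0 : Fin 4) ≠ 3 by decide)
  have h12 := hσ σ (show (1 : Fin 4) ≠ 2 by decide)
  have h13 := hσ σ (show (1 : Fin 4) ≠ 3 by decide)
  have h23 := hσ σ (show (2 : Fin 4) ≠ 3 by decide)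
  rw [← hU (Fin.revPerm.trans σ)]
  exact exists_agreeOn_of_three_cover hP (hc (σ 3)) (hc (σ 2)) (hc (σ 1)) (hc (σ 0)) (aE _) (aE _)
    (aE _) (aE _) hY (cover _ _ _ h23.symm h13.symm h12.symm)
    (cover _ _ _ h23.symm h03.symm h02.symm) (cover _ _ _ h13.symm h03.symm h01.symm)
    (cover _ _ _ h12.symm h02.symm h01.symm) (hA' _ _ h23.symm) (hA' _ _ h13) (hA' _ _ h03)
    (hA' _ _ h12) (hA' _ _ h02) (hmin' _ _ h23.symm) (hmin' _ _ h13) (hmin' _ _ h03)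
    (hmin' _ _ h12) (hmin' _ _ h02) (hgen (Fin.revPerm.trans σ))

end Combinatorics

lemma agreeOn_image {V : Type*} [DecidableEq V] {p p' : V → ℂ × ℂ} (hp : IsGeneral p)
    (hp' : IsGeneral p') {t : Fin 4 → V} (ht : Function.Injective t)
    (h : crossRatio p (t 0) (t 1) (t 2) (t 3) = crossRatio p' (t 0) (t 1) (t 2) (t 3)) :
    AgreeOn p p' (Finset.univ.image t) := by
  have h01 := ht.ne (show (0 : Fin 4) ≠ 1 by decide)
  have h02 := ht.ne (show (0 : Fin 4) ≠ 2 by decide)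
  have h12 := ht.ne (show (1 : Fin 4) ≠ 2 by decide)
  refine agreeOn_of_base hp hp' h01 h02 h12 fun v hv => ?_
  obtain ⟨j, -, rfl⟩ := Finset.mem_image.1 hv
  fin_cases j
  · simp [crossRatio, bracket_self]
  · exact (crossRatio_base_zero _ _ _).trans (crossRatio_base_zero _ _ _).symm
  · exact (crossRatio_base_one hp h02 h12).trans (crossRatio_base_one hp' h02 h12).symm
  · exact h

section Genericity

variable {V : Type*} [DecidableEq V] {p : V → ℂ × ℂ} {E : Fin 4 → Finset V} {b : Fin 4 → ℂ}

lemma exists_anharmonic_of_subset_image (hp : IsGeneral p) {t : Fin 4 → V}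
    (ht : Function.Injective t) {a : ℂ} (h0 : a ≠ 0) (h1 : a ≠ 1)
    (ha : crossRatio p (t 0) (t 1) (t 2) (t 3) = a) {w x y z : V} (hnd : [w, x, y, z].Nodup)
    (hsub : {w, x, y, z} ⊆ Finset.univ.image t) :
    ∃ c ≠ 0, crossRatio p w x y z = anharmonic c a := by
  refine exists_anharmonic hp ht h0 h1 ha (s := ![w, x, y, z]) ?_ fun i => ?_
  · rw [← List.nodup_ofFn]
    simpa using hnd
  · have h : ![w, x, y, z] i ∈ Finset.univ.image t := hsub (by fin_cases i <;> simp)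
    simpa using h

lemma ne_of_anharmonic_mul_ne_one (hp : IsGeneral p) (hc : ∀ i, (E i).card = 4)
    (hE : ∀ i w x y z, [w, x, y, z].Nodup → {w, x, y, z} ⊆ E i →
      ∃ c ≠ 0, crossRatio p w x y z = anharmonic c (b i))
    (hb : ∀ (σ : Equiv.Perm (Fin 4)) (c : Fin 4 → Fin 7), c 0 ≠ 0 →
      ∏ s, anharmonic (c s) (b (σ s)) ≠ 1) {i j : Fin 4} (hij : i ≠ j) : E i ≠ E j := by
  intro h
  obtain ⟨σ, rfl, rfl⟩ := exists_perm_zero_one i j hij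
  obtain ⟨w, x, y, z, hwx, hwy, hwz, hxy, hxz, hyz, hw⟩ := Finset.card_eq_four.1 (hc (σ 0))
  obtain ⟨c, hc0, hcr⟩ := hE (σ 0) w x y z (by simp [*]) hw.ge
  obtain ⟨d, -, hdr⟩ := hE (σ 1) x w y z (by simp [*, hwx.symm])
    (by rw [← h, hw, Finset.insert_comm])
  refine hb σ ![c, d, 0, 0] hc0 ?_
  simpa [Fin.prod_univ_four, anharmonic_zero, ← hcr, ← hdr] using
    crossRatio_mul_swap hp hwy hxz hxy hwz

lemma six_le_card_union (hp : IsGeneral p) (hc : ∀ i, (E i).card = 4)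
    (hE : ∀ i w x y z, [w, x, y, z].Nodup → {w, x, y, z} ⊆ E i →
      ∃ c ≠ 0, crossRatio p w x y z = anharmonic c (b i))
    (hb : ∀ (σ : Equiv.Perm (Fin 4)) (c : Fin 4 → Fin 7), c 0 ≠ 0 →
      ∏ s, anharmonic (c s) (b (σ s)) ≠ 1) {i j k : Fin 4} (hij : i ≠ j) (hik : i ≠ k)
    (hjk : j ≠ k) : 6 ≤ (E i ∪ E j ∪ E k).card := by
  by_contra! hlt
  have hne {i j : Fin 4} (h : i ≠ j) := ne_of_anharmonic_mul_ne_one hp hc hE hb h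
  set Y := E i ∪ E j ∪ E k with hY
  have si : E i ⊆ Y := Finset.subset_union_left.trans Finset.subset_union_left
  have sj : E j ⊆ Y := Finset.subset_union_right.trans Finset.subset_union_left
  have sk : E k ⊆ Y := Finset.subset_union_right
  have hY4 : Y.card ≠ 4 := fun h => hne hij <|
    (Finset.eq_of_subset_of_card_le si (by rw [h, hc])).trans
      (Finset.eq_of_subset_of_card_le sj (by rw [h, hc])).symm
  have hY5 : Y.card = 5 := by
    have := Finset.card_le_card si
    rw [hc] at this
    omega
  have miss {l : Fin 4} (hl : E l ⊆ Y) : ∃ u, Y \ E l = {u} := by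
    rw [← Finset.card_eq_one, Finset.card_sdiff_of_subset hl, hY5, hc]
  have distinct {l m : Fin 4} (hlm : l ≠ m) (hl : E l ⊆ Y) (hm : E m ⊆ Y) {u v : V}
      (hu : Y \ E l = {u}) (hv : Y \ E m = {v}) : u ≠ v := by
    rintro rfl
    refine hne hlm ?_
    rw [← Finset.sdiff_sdiff_eq_self hl, hu, ← hv, Finset.sdiff_sdiff_eq_self hm]
  have mem {l : Fin 4} {u t : V} (hu : Y \ E l = {u}) (ht : t ∈ Y) (htu : t ≠ u) : t ∈ E l := by
    by_contra h
    exact htu (Finset.mem_singleton.1 (hu ▸ Finset.mem_sdiff.2 ⟨ht, h⟩))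
  obtain ⟨u, hu⟩ := miss si
  obtain ⟨v, hv⟩ := miss sj
  obtain ⟨y, hy⟩ := miss sk
  have huv := distinct hij si sj hu hv
  have huy := distinct hik si sk hu hy
  have hvy := distinct hjk sj sk hv hy
  have huY : u ∈ Y := (Finset.mem_sdiff.1 (hu.ge (Finset.mem_singleton_self u))).1
  have hvY : v ∈ Y := (Finset.mem_sdiff.1 (hv.ge (Finset.mem_singleton_self v))).1
  have hyY : y ∈ Y := (Finset.mem_sdiff.1 (hy.ge (Finset.mem_singleton_self y))).1
  have h2 : (Y \ {u, v, y}).card = 2 := by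
    have hs : {u, v, y} ⊆ Y := by
      simp only [Finset.insert_subset_iff, Finset.singleton_subset_iff]
      exact ⟨huY, hvY, hyY⟩
    rw [Finset.card_sdiff_of_subset hs, hY5,
      Finset.card_eq_three.2 ⟨u, v, y, huv, huy, hvy, rfl⟩]
  obtain ⟨w, x, hwx, hwxe⟩ := Finset.card_eq_two.1 h2
  have hw : w ∈ Y \ {u, v, y} := by simp [hwxe]
  have hx : x ∈ Y \ {u, v, y} := by simp [hwxe]
  simp only [Finset.mem_sdiff, Finset.mem_insert, Finset.mem_singleton, not_or] at hw hx
  obtain ⟨hwY, hwu, hwv, hwy⟩ := hw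
  obtain ⟨hxY, hxu, hxv, hxy⟩ := hx
  obtain ⟨σ, rfl, rfl, rfl⟩ := exists_perm_eq i j k hij hik hjk
  have quad {l : Fin 4} {m s t : V} (hm : Y \ E l = {m}) (hs : s ∈ Y) (ht : t ∈ Y) (hsm : s ≠ m)
      (htm : t ≠ m) (hwm : w ≠ m) (hxm : x ≠ m) : {w, x, s, t} ⊆ E l := by
    simp only [Finset.insert_subset_iff, Finset.singleton_subset_iff]
    exact ⟨mem hm hwY hwm, mem hm hxY hxm, mem hm hs hsm, mem hm ht htm⟩
  obtain ⟨c, hc0, hcr⟩ := hE (σ 0) w x y v (by simp [*, hvy.symm])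
    (quad hu hyY hvY huy.symm huv.symm hwu hxu)
  obtain ⟨d, -, hdr⟩ := hE (σ 1) w x u y (by simp [*]) (quad hv huY hyY huv hvy.symm hwv hxv)
  obtain ⟨e, -, her⟩ := hE (σ 2) w x v u (by simp [*, huv.symm]) (quad hy hvY huY hvy huy hwy hxy)
  refine hb σ ![c, d, e, 0] hc0 ?_
  have h := crossRatio_cycle hp hwy hxy hwv hxv hwu hxu
  rw [mul_right_comm] at h
  simpa [Fin.prod_univ_four, anharmonic_zero, ← hcr, ← hdr, ← her] using h

lemma crossRatio_mul_ne_mul (hp : IsGeneral p)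
    (hE : ∀ i w x y z, [w, x, y, z].Nodup → {w, x, y, z} ⊆ E i →
      ∃ c ≠ 0, crossRatio p w x y z = anharmonic c (b i))
    (hb : ∀ (σ : Equiv.Perm (Fin 4)) (c : Fin 4 → Fin 7), c 0 ≠ 0 →
      ∏ s, anharmonic (c s) (b (σ s)) ≠ 1) (σ : Equiv.Perm (Fin 4)) {A B C x y z w : V}
    (hnd : [A, B, C, x, y, z, w].Nodup) (h₁ : {A, B, x, y} ⊆ E (σ 0))
    (h₂ : {A, B, z, w} ⊆ E (σ 1)) (h₃ : {A, C, x, z} ⊆ E (σ 2)) (h₄ : {A, C, y, w} ⊆ E (σ 3)) :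
    crossRatio p A B x y * crossRatio p A C y w ≠
      crossRatio p A B z w * crossRatio p A C x z := by
  simp only [List.nodup_cons, List.mem_cons, List.not_mem_nil, or_false, not_or, not_false_iff,
    List.nodup_nil, and_true] at hnd
  obtain ⟨⟨hAB, hAC, hAx, hAy, hAz, hAw⟩, ⟨hBC, hBx, hBy, hBz, hBw⟩, ⟨hCx, hCy, hCz, hCw⟩,
    ⟨hxy, hxz, hxw⟩, ⟨hyz, hyw⟩, hzw⟩ := hnd
  intro h
  obtain ⟨c₁, hc, hc₁⟩ := hE (σ 0) A B x y (by simp [*]) h₁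
  obtain ⟨c₂, -, hc₂⟩ := hE (σ 1) B A z w (by simp [*, Ne.symm hAB])
    (by rwa [Finset.insert_comm])
  obtain ⟨c₃, -, hc₃⟩ := hE (σ 2) C A x z (by simp [*, Ne.symm hAC])
    (by rwa [Finset.insert_comm])
  obtain ⟨c₄, -, hc₄⟩ := hE (σ 3) A C y w (by simp [*]) h₄
  refine hb σ ![c₁, c₂, c₃, c₄] hc ?_
  have h2 := crossRatio_ne_zero hp hAz hBw hBz hAw
  have h3 := crossRatio_ne_zero hp hAx hCz hCx hAz
  rw [crossRatio_swap_left] at hc₂ hc₃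
  simp only [Fin.prod_univ_four, Matrix.cons_val, ← hc₁, ← hc₂, ← hc₃, ← hc₄]
  field_simp
  linear_combination h

/-- Among three solutions of four generic cross-ratio equations on seven points, two are
equivalent. -/
lemma exists_agreeOn_of_crossRatio_eq {P : Fin 3 → V → ℂ × ℂ} (hP : ∀ s, IsGeneral (P s))
    {t : Fin 4 → Fin 4 → V} (ht : ∀ i, Function.Injective (t i)) (hb : ∀ i, b i ≠ 0 ∧ b i ≠ 1)
    (hcr : ∀ s i, crossRatio (P s) (t i 0) (t i 1) (t i 2) (t i 3) = b i)
    (hY : (Finset.univ.biUnion fun i => Finset.univ.image (t i)).card = 7)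
    (hgen : ∀ (σ : Equiv.Perm (Fin 4)) (c : Fin 4 → Fin 7), c 0 ≠ 0 →
      ∏ s, anharmonic (c s) (b (σ s)) ≠ 1) :
    ∃ s s', s ≠ s' ∧
      AgreeOn (P s) (P s') (Finset.univ.biUnion fun i => Finset.univ.image (t i)) := by
  have hc i : (Finset.univ.image (t i)).card = 4 := by
    rw [Finset.card_image_of_injective _ (ht i), Finset.card_fin]
  have hE i w x y z (hnd : [w, x, y, z].Nodup) (hsub : {w, x, y, z} ⊆ Finset.univ.image (t i)) :
      ∃ c ≠ 0, crossRatio (P 0) w x y z = anharmonic c (b i) :=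
    exists_anharmonic_of_subset_image (hP 0) (ht i) (hb i).1 (hb i).2 (hcr 0 i) hnd hsub
  exact exists_agreeOn_biUnion hP hc
    (fun i s s' => agreeOn_image (hP s) (hP s') (ht i) ((hcr s i).trans (hcr s' i).symm)) hY
    (fun i j hij => ne_of_anharmonic_mul_ne_one (hP 0) hc hE hgen hij)
    (fun i j k hij hik hjk => six_le_card_union (hP 0) hc hE hgen hij hik hjk)
    (fun σ A B C x y z w hnd h₁ h₂ h₃ h₄ =>
      crossRatio_mul_ne_mul (hP 0) hE hgen σ hnd h₁ h₂ h₃ h₄)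

end Genericity

section HomCoord

lemma bracket_homCoord_ne_zero {z w : OnePoint ℂ} (h : z ≠ w) :
    bracket (homCoord z) (homCoord w) ≠ 0 := by
  rcases z with _ | z <;> rcases w with _ | w
  · exact absurd rfl h
  · simp [bracket, homCoord]
  · simp [bracket, homCoord]
  · have : z ≠ w := fun h' => h (by rw [h'])
    simpa [bracket, homCoord, sub_eq_zero] using this

lemma isGeneral_homCoord {V : Type*} {p : V → OnePoint ℂ} (hp : Function.Injective p) :
    IsGeneral fun v => homCoord (p v) :=
  fun _ _ h => bracket_homCoord_ne_zero (hp.ne h)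

lemma crossRatio_homCoord {V : Type*} {p : V → OnePoint ℂ} (hp : Function.Injective p)
    {w x y z : V} (hnd : [w, x, y, z].Nodup) :
    crossRatio (fun v => homCoord (p v)) w x y z = CR (p w) (p x) (p y) (p z) := by
  simp only [List.nodup_cons, List.mem_cons, List.not_mem_nil, or_false, not_or, not_false_iff,
    List.nodup_nil, and_true] at hnd
  obtain ⟨⟨hwx, hwy, hwz⟩, ⟨hxy, hxz⟩, hyz⟩ := hnd
  replace hwx := hp.ne hwx
  replace hwy := hp.ne hwy
  replace hwz := hp.ne hwz
  replace hxy := hp.ne hxy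
  replace hxz := hp.ne hxz
  replace hyz := hp.ne hyz
  simp only [crossRatio]
  generalize p w = w at *
  generalize p x = x at *
  generalize p y = y at *
  generalize p z = z at *
  have neg_div_neg (a b c d : ℂ) : (a - b) / (c - d) = (b - a) / (d - c) := by
    rw [← neg_sub b, ← neg_sub d, neg_div_neg_eq]
  rcases w with _ | w
  · rcases x with _ | x
    · exact absurd rfl hwx
    rcases y with _ | y
    · exact absurd rfl hwy
    rcases z with _ | z
    · exact absurd rfl hwz
    simpa [bracket, homCoord, CR] using neg_div_neg _ _ _ _
  · rcases x with _ | x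
    · rcases y with _ | y
      · exact absurd rfl hxy
      rcases z with _ | z
      · exact absurd rfl hxz
      simpa [bracket, homCoord, CR] using neg_div_neg _ _ _ _
    · rcases y with _ | y
      · rcases z with _ | z
        · exact absurd rfl hyz
        simp [bracket, homCoord, CR]
      · rcases z with _ | z
        · simp [bracket, homCoord, CR]
        · simp only [bracket, homCoord, CR]
          congr 1 <;> ring

lemma crossRatio_homCoord_base {V : Type*} {p : V → OnePoint ℂ} (hp : Function.Injective p)
    {b₁ b₂ b₃ : V} (h₁ : p b₁ = ∞) (h₂ : p b₂ = ((0 : ℂ) : OnePoint ℂ))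
    (h₃ : p b₃ = ((1 : ℂ) : OnePoint ℂ)) {v : V} (hv : v ≠ b₁) :
    p v = ((crossRatio (fun v => homCoord (p v)) b₁ b₂ b₃ v : ℂ) : OnePoint ℂ) := by
  have hne : p v ≠ ∞ := h₁ ▸ hp.ne hv
  obtain ⟨z, hz⟩ := OnePoint.ne_infty_iff_exists.1 hne
  have hi : homCoord ∞ = (1, 0) := rfl
  have hs (z : ℂ) : homCoord (z : OnePoint ℂ) = (z, 1) := rfl
  simp [crossRatio, h₁, h₂, h₃, ← hz, hi, hs, bracket]

lemma eq_of_agreeOn_homCoord {V : Type*} [Fintype V] {p p' : V → OnePoint ℂ}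
    (hp : Function.Injective p) (hp' : Function.Injective p') {b₁ b₂ b₃ : V} (h₁ : p b₁ = ∞)
    (h₂ : p b₂ = ((0 : ℂ) : OnePoint ℂ)) (h₃ : p b₃ = ((1 : ℂ) : OnePoint ℂ)) (h₁' : p' b₁ = ∞)
    (h₂' : p' b₂ = ((0 : ℂ) : OnePoint ℂ)) (h₃' : p' b₃ = ((1 : ℂ) : OnePoint ℂ))
    (h : AgreeOn (fun v => homCoord (p v)) (fun v => homCoord (p' v)) Finset.univ) :
    p = p' := by
  funext v
  by_cases hv : v = b₁
  · rw [hv, h₁, h₁']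
  · rw [crossRatio_homCoord_base hp h₁ h₂ h₃ hv, crossRatio_homCoord_base hp' h₁' h₂' h₃' hv,
      h _ (Finset.mem_univ _) _ (Finset.mem_univ _) _ (Finset.mem_univ _) _ (Finset.mem_univ _)]

end HomCoord

lemma biUnion_succAbove_eq_erase {T : Fin 5 → Fin 4 → Fin 8} (hcov : ∀ v : Fin 8, ∃ i j, T i j = v)
    (hno2 : ∀ i : Fin 5, ∀ v w : Fin 8, (∃ j, T i j = v) → (∃ j, T i j = w) →
      degT T v = 1 → degT T w = 1 → v = w) {v : Fin 8} (hv : degT T v = 1) {i : Fin 5}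
    (hi : ∃ j, T i j = v) :
    (Finset.univ.biUnion fun s => Finset.univ.image (T (i.succAbove s))) =
      Finset.univ.erase v := by
  ext w
  simp only [Finset.mem_biUnion, Finset.mem_univ, true_and, Finset.mem_image, Finset.mem_erase,
    and_true]
  refine ⟨?_, fun hw => ?_⟩
  · rintro ⟨s, hs⟩ rfl
    exact Fin.succAbove_ne i s (Finset.card_le_one.1 hv.le _
      (Finset.mem_filter.2 ⟨Finset.mem_univ _, hs⟩) _
      (Finset.mem_filter.2 ⟨Finset.mem_univ _, hi⟩))
  · suffices h : ∃ k, k ≠ i ∧ ∃ j, T k j = w by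
      obtain ⟨k, hk, h⟩ := h
      obtain ⟨s, rfl⟩ := Fin.exists_succAbove_eq hk
      exact ⟨s, h⟩
    obtain ⟨k, hk⟩ := hcov w
    by_cases hki : k = i
    · subst hki
      have hd : degT T w ≠ 1 := fun h => hw (hno2 k w v hk hi h hv)
      have hpos : 0 < degT T w :=
        Finset.card_pos.2 ⟨k, Finset.mem_filter.2 ⟨Finset.mem_univ _, hk⟩⟩
      obtain ⟨l, hl, hlk⟩ := Finset.exists_mem_ne (show 1 < degT T w by omega) k
      exact ⟨l, hlk, (Finset.mem_filter.1 hl).2⟩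
    · exact ⟨k, hki, hk⟩

/-- If some vertex has degree 1 and no tuple contains two or more vertices of
degree 1, then the cross-ratio degree is at most 2. -/
theorem crossRatioDegree_le_two_of_deg_one_vertex
    (T : Fin 5 → Fin 4 → Fin 8)
    (hT : ∀ i, Function.Injective (T i))
    (hcov : ∀ v : Fin 8, ∃ i j, T i j = v)
    (hdeg1 : ∃ v : Fin 8, degT T v = 1)
    (hno2 : ∀ i : Fin 5, ∀ v w : Fin 8, (∃ j, T i j = v) → (∃ j, T i j = w) →
      degT T v = 1 → degT T w = 1 → v = w) :
    ∃ q : MvPolynomial (Fin 5) ℂ, q ≠ 0 ∧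
      ∀ a : Fin 5 → ℂ, (∀ i, a i ≠ 0 ∧ a i ≠ 1) → MvPolynomial.eval a q ≠ 0 →
        let S : Set (Fin 8 → OnePoint ℂ) :=
          {p | Function.Injective p ∧ p 0 = ∞ ∧ p 1 = ((0 : ℂ) : OnePoint ℂ) ∧
            p 2 = ((1 : ℂ) : OnePoint ℂ) ∧
            ∀ i, CR (p (T i 0)) (p (T i 1)) (p (T i 2)) (p (T i 3)) = a i}
        S.Finite ∧ S.ncard ≤ 2 := by
  obtain ⟨v, hv⟩ := hdeg1
  obtain ⟨i, hi⟩ := hcov v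
  have hY := biUnion_succAbove_eq_erase hcov hno2 hv hi
  obtain ⟨q, hq, hgen⟩ := exists_polynomial_anharmonic_mul_ne_one (n := 5)
  refine ⟨q, hq, fun a ha hqa => ?_⟩
  intro S
  suffices h : S.encard ≤ (2 : ℕ) from Set.encard_le_coe_iff_finite_ncard_le.1 h
  by_contra! hlt
  obtain ⟨S', hS', hcard⟩ := Set.exists_subset_encard_eq
    (show (3 : ℕ∞) ≤ S.encard from Order.add_one_le_of_lt hlt)
  obtain ⟨p₀, p₁, p₂, h01, h02, h12, rfl⟩ := Set.encard_eq_three.1 hcard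
  have hmem : ∀ s, ![p₀, p₁, p₂] s ∈ S := fun s => hS' (by fin_cases s <;> simp)
  have hinj : Function.Injective ![p₀, p₁, p₂] := by
    rw [← List.nodup_ofFn]
    simp [*]
  generalize ![p₀, p₁, p₂] = Q at hmem hinj
  have hP s : IsGeneral fun v => homCoord (Q s v) := isGeneral_homCoord (hmem s).1
  have hcr s k : crossRatio (fun v => homCoord (Q s v)) (T k 0) (T k 1) (T k 2) (T k 3) = a k := by
    rw [crossRatio_homCoord (hmem s).1 (by simpa using List.nodup_ofFn.2 (hT k))]
    exact (hmem s).2.2.2.2 k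
  obtain ⟨s, t, hst, h⟩ := exists_agreeOn_of_crossRatio_eq hP (t := fun s => T (i.succAbove s))
    (b := fun s => a (i.succAbove s)) (fun s => hT _) (fun s => ha _) (fun s k => hcr s _)
    (by rw [hY]; simp) (fun σ c hc => hgen a ha hqa (fun s => i.succAbove (σ s))
      (Fin.succAbove_right_injective.comp σ.injective) c hc)
  rw [hY] at h
  refine hst (hinj ?_)
  have hv' : v ∈ Finset.univ.image (T i) := by simpa using hi
  have h' := h.union (hP s) (hP t)
    (agreeOn_image (hP s) (hP t) (hT i) ((hcr s i).trans (hcr t i).symm)) (by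
      rw [Finset.erase_inter, Finset.univ_inter, Finset.card_erase_of_mem hv',
        Finset.card_image_of_injective _ (hT i), Finset.card_fin])
  refine eq_of_agreeOn_homCoord (hmem s).1 (hmem t).1 (hmem s).2.1 (hmem s).2.2.1
    (hmem s).2.2.2.1 (hmem t).2.1 (hmem t).2.2.1 (hmem t).2.2.2.1 (h'.mono fun w _ => ?_)
  by_cases hw : w = v
  · exact Finset.mem_union_right _ (hw ▸ hv')
  · exact Finset.mem_union_left _ (Finset.mem_erase.2 ⟨hw, Finset.mem_univ w⟩)
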